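/- arXiv:1008.1266 — 3 statements merged into one kernel-verified Lean document; each statement's English description precedes it below -/
import Mathlib

section
/- Let 0 < |λ| ≤ 2 and let the displacements ω_k be i.i.d. with ℙ(ω_k = 0) = p and ℙ(ω_k = 1) = 1−p for some p ∈ (0,1). Then for ℙ-almost every ω ∈ {0,1}^ℤ, σ(h_{ω,λ}) = [E_−(λ), E_+(λ)] ∖ (G_−(λ), G_+(λ)), where E_±(λ) = λ/2 ± √(2 + λ²/4 + √(4+λ²)) and G_±(λ) = λ/2 ± √(2 + λ²/4 − √(4+λ²)). -/
open scoped BigOperators ENNReal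
open MeasureTheory

noncomputable section

/-- `ℓ²(ℤ)` with real coefficients. -/
abbrev l2Z := lp (fun _ : ℤ => ℝ) 2

open Classical in
/-- The potential of the Bernoulli displacement model: `V_ω(n) = λ` if
`n = 2k + 1 + ω_k` for some `k ∈ ℤ`, and `V_ω(n) = 0` otherwise. -/
def Vbdm (lam : ℝ) (ω : ℤ → ℤ) (n : ℤ) : ℝ :=
  if ∃ k : ℤ, n = 2 * k + 1 + ω k then lam else 0

theorem l2Z_norm_sq (u : l2Z) : ‖u‖ ^ 2 = ∑' n, u n ^ 2 := by
  have h := lp.norm_rpow_eq_tsum (p := 2) (by norm_num) u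
  simpa using h

theorem l2Z_summable_sq (u : l2Z) : Summable fun n => u n ^ 2 := by
  have h := (lp.memℓp u).summable (p := 2) (by norm_num)
  simpa using h

theorem memℓp_neg_comp (σ : ℤ ≃ ℤ) (u : l2Z) :
    Memℓp (E := fun _ : ℤ => ℝ) (fun n => -u (σ n)) 2 :=
  memℓp_gen (by
    have h := (σ.summable_iff (f := fun n => u n ^ 2)).2 (l2Z_summable_sq u)
    simpa [Function.comp_def] using h)

/-- The negative of the permutation operator `u ↦ u ∘ σ` on `ℓ²(ℤ)`, as a linear map. -/
def negPermuteLinear (σ : ℤ ≃ ℤ) : l2Z →ₗ[ℝ] l2Z where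
  toFun u := ⟨fun n => -u (σ n), memℓp_neg_comp σ u⟩
  map_add' u v := by
    ext n
    change -(u (σ n) + v (σ n)) = -u (σ n) + -v (σ n)
    ring
  map_smul' c u := by
    ext n
    change -(c * u (σ n)) = c * -u (σ n)
    ring

theorem norm_negPermuteLinear_le (σ : ℤ ≃ ℤ) (u : l2Z) : ‖negPermuteLinear σ u‖ ≤ 1 * ‖u‖ := by
  rw [one_mul]
  refine (sq_le_sq₀ (norm_nonneg _) (norm_nonneg _)).1 (le_of_eq ?_)
  rw [l2Z_norm_sq, l2Z_norm_sq, ← σ.tsum_eq (fun n => u n ^ 2)]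
  exact tsum_congr fun n => neg_sq (u (σ n))

/-- The negative of the permutation operator `u ↦ u ∘ σ` on `ℓ²(ℤ)`. -/
def negPermute (σ : ℤ ≃ ℤ) : l2Z →L[ℝ] l2Z :=
  LinearMap.mkContinuous (negPermuteLinear σ) 1 (norm_negPermuteLinear_le σ)

theorem negPermute_apply (σ : ℤ ≃ ℤ) (u : l2Z) (n : ℤ) : negPermute σ u n = -u (σ n) := rfl

theorem norm_negPermute_le (σ : ℤ ≃ ℤ) : ‖negPermute σ‖ ≤ 1 :=
  LinearMap.mkContinuous_norm_le _ zero_le_one _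

/-- The involution of `ℤ` exchanging `2k + 1` and `2k + 2`. -/
def swapWithin : ℤ ≃ ℤ where
  toFun n := if n % 2 = 1 then n + 1 else n - 1
  invFun n := if n % 2 = 1 then n + 1 else n - 1
  left_inv n := by dsimp only; split_ifs <;> omega
  right_inv n := by dsimp only; split_ifs <;> omega

/-- The involution of `ℤ` exchanging `2k` and `2k + 1`. -/
def swapBetween : ℤ ≃ ℤ where
  toFun n := if n % 2 = 1 then n - 1 else n + 1
  invFun n := if n % 2 = 1 then n - 1 else n + 1
  left_inv n := by dsimp only; split_ifs <;> omega
  right_inv n := by dsimp only; split_ifs <;> omega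

theorem swapWithin_odd (k : ℤ) : swapWithin (2 * k + 1) = 2 * k + 2 := by
  simp [swapWithin]; omega

theorem swapWithin_even (k : ℤ) : swapWithin (2 * k + 2) = 2 * k + 1 := by
  simp [swapWithin]; omega

theorem Vbdm_odd (lam : ℝ) {ω : ℤ → ℤ} (hω : ∀ k, ω k = 0 ∨ ω k = 1) (k : ℤ) :
    Vbdm lam ω (2 * k + 1) = if ω k = 0 then lam else 0 := by
  unfold Vbdm
  congr 1
  refine propext ⟨fun ⟨j, hj⟩ => ?_, fun h => ⟨k, by omega⟩⟩
  have := hω j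
  obtain rfl : j = k := by omega
  omega

theorem Vbdm_even (lam : ℝ) {ω : ℤ → ℤ} (hω : ∀ k, ω k = 0 ∨ ω k = 1) (k : ℤ) :
    Vbdm lam ω (2 * k + 2) = if ω k = 0 then 0 else lam := by
  unfold Vbdm
  have := hω k
  by_cases h0 : ω k = 0
  · rw [if_pos h0, if_neg]
    rintro ⟨j, hj⟩
    have := hω j
    obtain rfl : j = k := by omega
    omega
  · rw [if_neg h0, if_pos ⟨k, by omega⟩]

/-- An operator acting on each pair `{2k + 1, 2k + 2}` as the symmetric traceless matrix
`!![d, -1; -1, -d]` with `d ^ 2 = a` squares to `1 + a` and scales norms by `√(1 + a)`. -/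
theorem dimer_comp_self_and_norm (a : ℝ) (D : l2Z →L[ℝ] l2Z) (d : ℤ → ℝ)
    (hd : ∀ n, d n ^ 2 = a) (hd' : ∀ n, d (swapWithin n) = -d n)
    (hD : ∀ u n, D u n = -u (swapWithin n) + d n * u n) :
    D * D = (1 + a) • (1 : l2Z →L[ℝ] l2Z) ∧ ‖D‖ ≤ Real.sqrt (1 + a) := by
  have hinv : ∀ n, swapWithin (swapWithin n) = n := swapWithin.left_inv
  constructor
  · ext u n
    have h : (D (D u)) n = (1 + a) * u n := by
      rw [hD, hD, hD, hinv, hd', ← hd n]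
      ring
    simpa using h
  · refine ContinuousLinearMap.opNorm_le_bound _ (Real.sqrt_nonneg _) fun u => ?_
    refine (sq_le_sq₀ (norm_nonneg _) (by positivity)).1 ?_
    have ha : 0 ≤ a := hd 0 ▸ sq_nonneg _
    rw [mul_pow, Real.sq_sqrt (by positivity)]
    have hpt : ∀ n, (D u n) ^ 2 + (D u (swapWithin n)) ^ 2 =
        (1 + a) * (u n ^ 2 + u (swapWithin n) ^ 2) := fun n => by
      rw [hD, hD, hinv, hd', ← hd n]
      ring
    have key : ∀ v : l2Z, ∑' n, (v n ^ 2 + v (swapWithin n) ^ 2) = 2 * ‖v‖ ^ 2 := fun v => by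
      have hs := l2Z_summable_sq v
      have hs' : Summable fun n => v (swapWithin n) ^ 2 :=
        (swapWithin.summable_iff (f := fun n => v n ^ 2)).2 hs
      rw [hs.tsum_add hs',
        swapWithin.tsum_eq (fun n => v n ^ 2), l2Z_norm_sq]
      ring
    have h1 := key (D u)
    rw [tsum_congr hpt, tsum_mul_left, key u] at h1
    linarith

theorem notMem_spectrum_add_of_mul_self_eq {A : Type*} [NormedRing A] [NormedAlgebra ℝ A]
    [CompleteSpace A] [NormOneClass A] {D J : A} {r : ℝ} (hr : 0 < r)
    (hDD : D * D = r ^ 2 • (1 : A)) (hD : ‖D‖ ≤ r) (hJ : ‖J‖ ≤ 1) {x : ℝ}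
    (hx : |x| < r - 1 ∨ r + 1 < |x|) : x ∉ spectrum ℝ (D + J) := by
  rcases hx with hx | hx
  · rw [spectrum.notMem_iff, ← IsUnit.neg_iff]
    set T := r⁻¹ ^ 2 • (D * (algebraMap ℝ A x - J)) with hT
    have hTn : ‖T‖ < 1 := by
      have h1 : ‖algebraMap ℝ A x - J‖ ≤ |x| + 1 := by
        refine (norm_sub_le _ _).trans ?_
        rw [norm_algebraMap', Real.norm_eq_abs]
        linarith
      have h2 : ‖T‖ ≤ r⁻¹ ^ 2 * (r * (|x| + 1)) := by
        rw [hT, norm_smul, Real.norm_of_nonneg (by positivity)]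
        have := norm_mul_le D (algebraMap ℝ A x - J)
        gcongr
        exact this.trans (by gcongr)
      refine h2.trans_lt ?_
      rw [show r⁻¹ ^ 2 * (r * (|x| + 1)) = (|x| + 1) / r by field_simp, div_lt_one hr]
      linarith
    have hDu : IsUnit D := by
      refine ⟨⟨D, r⁻¹ ^ 2 • D, ?_, ?_⟩, rfl⟩ <;>
      · simp only [mul_smul_comm, smul_mul_assoc, hDD, smul_smul]
        rw [← mul_pow, inv_mul_cancel₀ hr.ne', one_pow, one_smul]
    have h := hDu.mul (isUnit_one_sub_of_norm_lt_one hTn)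
    convert h using 1
    rw [hT, mul_sub, mul_one, mul_smul_comm, ← mul_assoc, hDD, smul_mul_assoc, smul_smul,
      ← mul_pow, inv_mul_cancel₀ hr.ne', one_pow, one_smul, one_mul]
    abel
  · intro hmem
    have h1 := spectrum.norm_le_norm_of_mem hmem
    have h2 := norm_add_le D J
    rw [Real.norm_eq_abs] at h1
    linarith

theorem notMem_spectrum_bdm {lam : ℝ} {ω : ℤ → ℤ} (hω : ∀ k, ω k = 0 ∨ ω k = 1)
    {K : l2Z →L[ℝ] l2Z}
    (hK : ∀ u n, K u n = -u (n - 1) - u (n + 1) + Vbdm lam ω n * u n) {E : ℝ}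
    (hE : |E - lam / 2| < Real.sqrt (1 + lam ^ 2 / 4) - 1 ∨
      Real.sqrt (1 + lam ^ 2 / 4) + 1 < |E - lam / 2|) :
    E ∉ spectrum ℝ K := by
  set J := negPermute swapBetween with hJdef
  set D := K - algebraMap ℝ (l2Z →L[ℝ] l2Z) (lam / 2) - J with hDdef
  have hDapp : ∀ u n, D u n = -u (swapWithin n) + (Vbdm lam ω n - lam / 2) * u n := by
    intro u n
    have h1 : D u n = K u n - lam / 2 * u n - J u n := by
      simp [hDdef, Algebra.algebraMap_eq_smul_one]
      rfl
    rw [h1, hK, hJdef, negPermute_apply]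
    simp only [swapWithin, swapBetween, Equiv.coe_fn_mk]
    split_ifs <;> ring
  have hcases : ∀ n : ℤ, (∃ k, n = 2 * k + 1) ∨ ∃ k, n = 2 * k + 2 := fun n => by
    rcases Int.even_or_odd' n with ⟨k, h | h⟩
    · exact .inr ⟨k - 1, by omega⟩
    · exact .inl ⟨k, h⟩
  obtain ⟨hDD, hDn⟩ := dimer_comp_self_and_norm (lam ^ 2 / 4) D (fun n => Vbdm lam ω n - lam / 2)
    (fun n => by
      obtain ⟨k, rfl⟩ | ⟨k, rfl⟩ := hcases n
      · simp only [Vbdm_odd lam hω]; split_ifs <;> ring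
      · simp only [Vbdm_even lam hω]; split_ifs <;> ring)
    (fun n => by
      obtain ⟨k, rfl⟩ | ⟨k, rfl⟩ := hcases n
      · simp only [swapWithin_odd, Vbdm_odd lam hω, Vbdm_even lam hω]; split_ifs <;> ring
      · simp only [swapWithin_even, Vbdm_odd lam hω, Vbdm_even lam hω]; split_ifs <;> ring) hDapp
  have : Nontrivial l2Z := ⟨lp.single 2 0 1, 0, fun h => by
    have := congrArg (fun u : l2Z => u 0) h
    simp at this⟩
  have hnot := notMem_spectrum_add_of_mul_self_eq (r := Real.sqrt (1 + lam ^ 2 / 4))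
    (by positivity) (by rw [Real.sq_sqrt (by positivity), hDD]) hDn
    (norm_negPermute_le swapBetween) hE
  rw [spectrum.notMem_iff] at hnot ⊢
  convert hnot using 1
  rw [map_sub, hDdef]
  abel

open ProbabilityTheory in
/-- Along a deterministic target sequence, almost every realisation of i.i.d. displacements agrees
with the target on some block of any prescribed length. -/
theorem ae_exists_block_eq {p : ℝ} (hp : 0 < p) (hp1 : p < 1)
    (P : Measure (ℤ → ℤ)) [IsProbabilityMeasure P]
    (hiid : ∀ (s : Finset ℤ) (g : ℤ → ℤ), (∀ k ∈ s, g k = 0 ∨ g k = 1) →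
      P {ω | ∀ k ∈ s, ω k = g k} =
        ∏ k ∈ s, (if g k = 0 then ENNReal.ofReal p else ENNReal.ofReal (1 - p)))
    (g : ℤ → ℤ) (hg : ∀ k, g k = 0 ∨ g k = 1) (n : ℕ) :
    ∀ᵐ ω ∂P, ∃ j : ℕ, ∀ k ∈ Finset.Ico ((j : ℤ) * n) (j * n + n), ω k = g k := by
  set B : ℕ → Finset ℤ := fun j => Finset.Ico ((j : ℤ) * n) (j * n + n) with hB
  set A : ℕ → Set (ℤ → ℤ) := fun j => {ω | ∀ k ∈ B j, ω k = g k} with hA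
  set w : ℤ → ℝ≥0∞ := fun k => if g k = 0 then ENNReal.ofReal p else ENNReal.ofReal (1 - p)
  have hmeas : ∀ j, MeasurableSet (A j) := fun j => by
    have : A j = ⋂ k ∈ B j, (fun ω : ℤ → ℤ => ω k) ⁻¹' {g k} := by
      ext ω; simp [hA]
    rw [this]
    exact Finset.measurableSet_biInter _ fun k _ =>
      measurable_pi_apply k (measurableSet_singleton _)
  have hPA : ∀ j, P (A j) = ∏ k ∈ B j, w k := fun j => hiid (B j) g fun k _ => hg k
  have hdisj : ∀ i j : ℕ, i ≠ j → Disjoint (B i) (B j) := by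
    intro i j hij
    rw [Finset.disjoint_left]
    intro k hi hj
    simp only [hB, Finset.mem_Ico] at hi hj
    rcases lt_or_gt_of_ne hij with h | h
    · have : ((i : ℤ) + 1) * n ≤ j * n :=
        mul_le_mul_of_nonneg_right (by exact_mod_cast h) (by positivity)
      linarith
    · have : ((j : ℤ) + 1) * n ≤ i * n :=
        mul_le_mul_of_nonneg_right (by exact_mod_cast h) (by positivity)
      linarith
  have hind : iIndepSet A P := by
    rw [iIndepSet_iff_meas_biInter hmeas]
    intro s
    have h1 : ⋂ i ∈ s, A i = {ω | ∀ k ∈ s.biUnion B, ω k = g k} := by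
      ext ω
      simp only [hA, Set.mem_iInter, Set.mem_ofPred_eq, Finset.mem_biUnion]
      exact ⟨fun h k ⟨i, hi, hk⟩ => h i hi k hk, fun h i hi k hk => h k ⟨i, hi, hk⟩⟩
    rw [h1, hiid _ g fun k _ => hg k, Finset.prod_biUnion fun i _ j _ hij => hdisj i j hij]
    exact Finset.prod_congr rfl fun j _ => (hPA j).symm
  set ε : ℝ≥0∞ := min (ENNReal.ofReal p) (ENNReal.ofReal (1 - p)) with hε
  have hεpos : ε ≠ 0 := by
    simp [hε, hp, hp1, min_eq_iff]
  have hlow : ∀ j, ε ^ n ≤ P (A j) := fun j => by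
    rw [hPA j]
    have hcard : (B j).card = n := by simp [hB]
    calc ε ^ n = ∏ _k ∈ B j, ε := by rw [Finset.prod_const, hcard]
      _ ≤ ∏ k ∈ B j, w k := Finset.prod_le_prod' fun k _ => by
        simp only [w]
        split_ifs
        · exact min_le_left _ _
        · exact min_le_right _ _
  have hsum : ∑' j, P (A j) = ∞ := by
    refine top_le_iff.1 (le_trans (le_of_eq ?_) (ENNReal.tsum_le_tsum hlow))
    rw [ENNReal.tsum_const_eq_top_of_ne_zero (pow_ne_zero _ hεpos)]
  have hlim := measure_limsup_eq_one hmeas hind hsum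
  have hae : ∀ᵐ ω ∂P, ω ∈ Filter.limsup A Filter.atTop :=
    (mem_ae_iff_prob_eq_one (MeasurableSet.measurableSet_limsup hmeas)).2 hlim
  filter_upwards [hae] with ω hω
  rw [Filter.mem_limsup_iff_frequently_mem] at hω
  obtain ⟨j, hj⟩ := hω.exists
  exact ⟨j, hj⟩

theorem l2Z_norm_sq_sum_single (s : Finset ℤ) (f : ℤ → ℝ) :
    ‖∑ i ∈ s, lp.single (E := fun _ : ℤ => ℝ) 2 i (f i)‖ ^ 2 = ∑ i ∈ s, f i ^ 2 := by
  have h := lp.norm_sum_single (E := fun _ : ℤ => ℝ) (p := 2) (by norm_num) f s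
  simpa using h

theorem l2Z_sum_single_apply (s : Finset ℤ) (f : ℤ → ℝ) (n : ℤ) :
    (∑ i ∈ s, lp.single (E := fun _ : ℤ => ℝ) 2 i (f i)) n = if n ∈ s then f n else 0 := by
  simp only [lp.coeFn_single, lp.coeFn_sum, Finset.sum_apply, Finset.sum_pi_single]

/-- Cutting off a bounded solution of the eigenvalue equation on a window costs only boundary
terms. -/
theorem sum_sq_le_of_local_solution {K : l2Z →L[ℝ] l2Z} {W : ℤ → ℝ}
    (hK : ∀ u n, K u n = -u (n - 1) - u (n + 1) + W n * u n) {E c : ℝ} (hc : 0 ≤ c)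
    (hbd : ∀ u, c * ‖u‖ ≤ ‖K u - E • u‖) {f : ℤ → ℝ} {L R : ℤ} (hLR : L + 1 < R) {S : ℝ}
    (hS : ∀ n, f n ^ 2 ≤ S)
    (hf : ∀ n ∈ Finset.Ico L R, f (n - 1) + f (n + 1) = (W n - E) * f n) :
    c ^ 2 * ∑ n ∈ Finset.Ico L R, f n ^ 2 ≤ 4 * S := by
  set u : l2Z := ∑ i ∈ Finset.Ico L R, lp.single (E := fun _ : ℤ => ℝ) 2 i (f i) with hu
  set g : ℤ → ℝ := fun n =>
    if n = L - 1 then -f L else if n = L then f (L - 1)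
      else if n = R - 1 then f R else if n = R then -f (R - 1) else 0 with hg
  have hui : ∀ n, u n = if L ≤ n ∧ n < R then f n else 0 := fun n => by
    rw [hu, l2Z_sum_single_apply]
    simp only [Finset.mem_Ico]
  have hres : K u - E • u =
      ∑ i ∈ ({L - 1, L, R - 1, R} : Finset ℤ), lp.single (E := fun _ : ℤ => ℝ) 2 i (g i) := by
    ext n
    rw [l2Z_sum_single_apply]
    have h1 : (K u - E • u) n = K u n - E * u n := rfl
    rw [h1, hK]
    have hfn : L ≤ n → n < R → f (n - 1) + f (n + 1) = (W n - E) * f n := fun h1 h2 =>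
      hf n (Finset.mem_Ico.2 ⟨h1, h2⟩)
    simp only [hui, Finset.mem_insert, Finset.mem_singleton, hg]
    by_cases h1 : n = L - 1
    · subst h1
      rw [if_neg (by omega), if_pos (by omega), if_neg (by omega), if_pos (by omega),
        if_pos rfl]
      simp
    by_cases h2 : n = L
    · subst h2
      rw [if_neg (by omega), if_pos (by omega), if_pos (by omega), if_pos (by omega),
        if_neg (by omega), if_pos rfl]
      linarith [hfn (by omega) (by omega)]
    by_cases h3 : n = R - 1
    · subst h3
      rw [if_pos (by omega), if_neg (by omega), if_pos (by omega), if_pos (by omega),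
        if_neg (by omega), if_neg (by omega), if_pos rfl]
      have := hfn (by omega) (by omega)
      rw [sub_add_cancel] at this
      linarith
    by_cases h4 : n = R
    · subst h4
      rw [if_pos (by omega), if_neg (by omega), if_neg (by omega), if_pos (by omega),
        if_neg (by omega), if_neg (by omega), if_neg (by omega), if_pos rfl]
      ring
    rw [if_neg (c := n = L - 1 ∨ n = L ∨ n = R - 1 ∨ n = R) (by omega)]
    by_cases h5 : L ≤ n ∧ n < R
    · rw [if_pos (by omega), if_pos (by omega), if_pos (by omega)]
      linarith [hfn h5.1 h5.2]
    · rw [if_neg (by omega), if_neg (by omega), if_neg (by omega)]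
      ring
  have hgS : ∀ i, g i ^ 2 ≤ S := fun i => by
    have hS0 : 0 ≤ S := (sq_nonneg _).trans (hS 0)
    simp only [hg]
    split_ifs <;> simp [hS, hS0]
  calc c ^ 2 * ∑ n ∈ Finset.Ico L R, f n ^ 2 = (c * ‖u‖) ^ 2 := by
        rw [mul_pow, hu, l2Z_norm_sq_sum_single]
    _ ≤ ‖K u - E • u‖ ^ 2 := by
        have := hbd u
        gcongr
    _ = ∑ i ∈ ({L - 1, L, R - 1, R} : Finset ℤ), g i ^ 2 := by
        rw [hres, l2Z_norm_sq_sum_single]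
    _ ≤ ({L - 1, L, R - 1, R} : Finset ℤ).card • S :=
        Finset.sum_le_card_nsmul _ _ _ fun i _ => hgS i
    _ ≤ 4 * S := by
        rw [nsmul_eq_mul]
        have hS0 : 0 ≤ S := (sq_nonneg _).trans (hS 0)
        gcongr
        exact_mod_cast Finset.card_le_four

theorem exists_bound_of_notMem_spectrum {K : l2Z →L[ℝ] l2Z} {E : ℝ} (hE : E ∉ spectrum ℝ K) :
    ∃ c > 0, ∀ u, c * ‖u‖ ≤ ‖K u - E • u‖ := by
  rw [spectrum.notMem_iff] at hE
  obtain ⟨T, hT⟩ := hE.exists_left_inv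
  refine ⟨(‖T‖ + 1)⁻¹, by positivity, fun u => ?_⟩
  have h1 : T (E • u - K u) = u := by
    have := congrArg (fun A : l2Z →L[ℝ] l2Z => A u) hT
    simpa [Algebra.algebraMap_eq_smul_one] using this
  rw [inv_mul_le_iff₀ (by positivity), norm_sub_rev]
  calc ‖u‖ = ‖T (E • u - K u)‖ := by rw [h1]
    _ ≤ ‖T‖ * ‖E • u - K u‖ := T.le_opNorm _
    _ ≤ (‖T‖ + 1) * ‖E • u - K u‖ := by gcongr; linarith

/-- A unimodular Floquet multiplier and Floquet solution over one period exist when the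
discriminant of the four-periodic problem lies in `[-2, 2]`. -/
theorem exists_floquet (c₀ c₁ c₂ c₃ : ℝ)
    (hD : |c₀ * c₁ * c₂ * c₃ - c₀ * c₁ - c₁ * c₂ - c₂ * c₃ - c₃ * c₀ + 2| ≤ 2) :
    ∃ (μ : ℂ) (z₀ z₁ z₂ z₃ : ℂ), ‖μ‖ = 1 ∧ 0 < ‖z₀‖ ^ 2 + ‖z₁‖ ^ 2 + ‖z₂‖ ^ 2 + ‖z₃‖ ^ 2 ∧
      μ⁻¹ * z₃ + z₁ = c₀ * z₀ ∧ z₀ + z₂ = c₁ * z₁ ∧ z₁ + z₃ = c₂ * z₂ ∧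
      z₂ + μ * z₀ = c₃ * z₃ := by
  set t := c₀ * c₁ * c₂ * c₃ - c₀ * c₁ - c₁ * c₂ - c₂ * c₃ - c₃ * c₀ + 2 with ht
  obtain ⟨ht1, ht2⟩ := abs_le.1 hD
  set θ := Real.arccos (t / 2)
  have hcos : Real.cos θ = t / 2 := Real.cos_arccos (by linarith) (by linarith)
  set μ : ℂ := Complex.exp (θ * Complex.I) with hμ
  have hμ1 : ‖μ‖ = 1 := Complex.norm_exp_ofReal_mul_I θ
  have hμ0 : μ ≠ 0 := Complex.exp_ne_zero _
  have hsum : μ + μ⁻¹ = t := by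
    have h := Complex.two_cos (θ : ℂ)
    rw [← Complex.ofReal_cos, hcos, neg_mul, Complex.exp_neg] at h
    rw [hμ, ← h]
    push_cast
    ring
  let M : Matrix (Fin 4) (Fin 4) ℂ :=
    !![(c₀ : ℂ), -1, 0, -μ⁻¹; -1, c₁, -1, 0; 0, -1, c₂, -1; -μ, 0, -1, c₃]
  have hdet : M.det = 0 := by
    have h1 : M.det = t - (μ + μ⁻¹) - (μ * μ⁻¹ - 1) * (c₁ * c₂ - 1) := by
      simp [M, Matrix.det_succ_row_zero, Fin.sum_univ_succ, ht, Fin.succAbove]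
      ring
    rw [h1, hsum, mul_inv_cancel₀ hμ0]
    ring
  obtain ⟨z, hz0, hz⟩ := Matrix.exists_mulVec_eq_zero_iff.2 hdet
  have e0 := congrFun hz 0
  have e1 := congrFun hz 1
  have e2 := congrFun hz 2
  have e3 := congrFun hz 3
  simp [M, Matrix.mulVec, dotProduct, Fin.sum_univ_succ] at e0 e1 e2 e3
  refine ⟨μ, z 0, z 1, z 2, z 3, hμ1, ?_, ?_, ?_, ?_, ?_⟩
  · by_contra hle
    apply hz0
    have h0 := sq_nonneg ‖z 0‖
    have h1 := sq_nonneg ‖z 1‖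
    have h2 := sq_nonneg ‖z 2‖
    have h3 := sq_nonneg ‖z 3‖
    ext i
    have : ‖z i‖ ^ 2 = 0 := by
      fin_cases i <;> simp only [Fin.zero_eta, Fin.mk_one, Fin.reduceFinMk] <;> linarith
    simpa using this
  all_goals grind

/-- The sequence with Floquet multiplier `μ` over period four taking the values
`z₀, z₁, z₂, z₃` at `1, 2, 3, 4`. -/
def floquet (μ z₀ z₁ z₂ z₃ : ℂ) (n : ℤ) : ℂ :=
  μ ^ ((n - 1) / 4) *
    if (n - 1) % 4 = 0 then z₀ else if (n - 1) % 4 = 1 then z₁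
      else if (n - 1) % 4 = 2 then z₂ else z₃

section floquet

variable (μ z₀ z₁ z₂ z₃ : ℂ) (q : ℤ)

theorem floquet_one : floquet μ z₀ z₁ z₂ z₃ (4 * q + 1) = μ ^ q * z₀ := by
  rw [floquet, show (4 * q + 1 - 1) / 4 = q by omega, if_pos (by omega)]

theorem floquet_two : floquet μ z₀ z₁ z₂ z₃ (4 * q + 2) = μ ^ q * z₁ := by
  rw [floquet, show (4 * q + 2 - 1) / 4 = q by omega, if_neg (by omega), if_pos (by omega)]

theorem floquet_three : floquet μ z₀ z₁ z₂ z₃ (4 * q + 3) = μ ^ q * z₂ := by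
  rw [floquet, show (4 * q + 3 - 1) / 4 = q by omega, if_neg (by omega), if_neg (by omega),
    if_pos (by omega)]

theorem floquet_four : floquet μ z₀ z₁ z₂ z₃ (4 * q + 4) = μ ^ q * z₃ := by
  rw [floquet, show (4 * q + 4 - 1) / 4 = q by omega, if_neg (by omega), if_neg (by omega),
    if_neg (by omega)]

theorem norm_floquet_sq_le (hμ : ‖μ‖ = 1) (n : ℤ) :
    ‖floquet μ z₀ z₁ z₂ z₃ n‖ ^ 2 ≤ ‖z₀‖ ^ 2 + ‖z₁‖ ^ 2 + ‖z₂‖ ^ 2 + ‖z₃‖ ^ 2 := by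
  have h0 := sq_nonneg ‖z₀‖
  have h1 := sq_nonneg ‖z₁‖
  have h2 := sq_nonneg ‖z₂‖
  have h3 := sq_nonneg ‖z₃‖
  rw [floquet, norm_mul, norm_zpow, hμ, one_zpow, one_mul]
  split_ifs <;> linarith

theorem sum_norm_floquet_sq (hμ : ‖μ‖ = 1) (m : ℤ) (N : ℕ) :
    ∑ n ∈ Finset.Ico (4 * m + 1) (4 * (m + N) + 1), ‖floquet μ z₀ z₁ z₂ z₃ n‖ ^ 2 =
      N * (‖z₀‖ ^ 2 + ‖z₁‖ ^ 2 + ‖z₂‖ ^ 2 + ‖z₃‖ ^ 2) := by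
  induction N with
  | zero => simp
  | succ N ih =>
    have hsplit : Finset.Ico (4 * m + 1) (4 * (m + (N + 1 : ℕ)) + 1) =
        Finset.Ico (4 * m + 1) (4 * (m + N) + 1) ∪
          {4 * (m + N) + 1, 4 * (m + N) + 2, 4 * (m + N) + 3, 4 * (m + N) + 4} := by
      ext n
      simp only [Finset.mem_Ico, Finset.mem_union, Finset.mem_insert, Finset.mem_singleton]
      push_cast
      omega
    rw [hsplit, Finset.sum_union, ih]
    · rw [Finset.sum_insert (by simp), Finset.sum_insert (by simp), Finset.sum_insert (by simp),
        Finset.sum_singleton, floquet_one, floquet_two, floquet_three, floquet_four]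
      simp only [norm_mul, norm_zpow, hμ, one_zpow, one_mul]
      push_cast
      ring
    · rw [Finset.disjoint_left]
      intro n
      simp only [Finset.mem_Ico, Finset.mem_insert, Finset.mem_singleton]
      omega

end floquet

/-- If the potential looks four-periodic on arbitrarily long windows, then every energy at which
the discriminant of the periodic problem lies in `[-2, 2]` belongs to the spectrum. -/
theorem mem_spectrum_of_periodic_windows {K : l2Z →L[ℝ] l2Z} {W : ℤ → ℝ}
    (hK : ∀ u n, K u n = -u (n - 1) - u (n + 1) + W n * u n) {E c₀ c₁ c₂ c₃ : ℝ}
    (hD : |c₀ * c₁ * c₂ * c₃ - c₀ * c₁ - c₁ * c₂ - c₂ * c₃ - c₃ * c₀ + 2| ≤ 2)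
    (hwin : ∀ N : ℕ, ∃ m : ℤ, ∀ q, m ≤ q → q < m + N → W (4 * q + 1) - E = c₀ ∧
      W (4 * q + 2) - E = c₁ ∧ W (4 * q + 3) - E = c₂ ∧ W (4 * q + 4) - E = c₃) :
    E ∈ spectrum ℝ K := by
  by_contra hE
  obtain ⟨c, hc, hbd⟩ := exists_bound_of_notMem_spectrum hE
  obtain ⟨μ, z₀, z₁, z₂, z₃, hμ, hpos, h0, h1, h2, h3⟩ := exists_floquet c₀ c₁ c₂ c₃ hD
  have hμ0 : μ ≠ 0 := norm_pos_iff.1 (hμ ▸ one_pos)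
  set S := ‖z₀‖ ^ 2 + ‖z₁‖ ^ 2 + ‖z₂‖ ^ 2 + ‖z₃‖ ^ 2 with hS
  set φ := floquet μ z₀ z₁ z₂ z₃ with hφ
  obtain ⟨N, hN⟩ := exists_nat_gt (8 / c ^ 2)
  have hN0 : 0 < N := by
    have : (0 : ℝ) < N := lt_trans (by positivity) hN
    exact_mod_cast this
  obtain ⟨m, hm⟩ := hwin N
  have hsol : ∀ n ∈ Finset.Ico (4 * m + 1) (4 * (m + N) + 1),
      φ (n - 1) + φ (n + 1) = ((W n - E : ℝ) : ℂ) * φ n := by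
    intro n hn
    rw [Finset.mem_Ico] at hn
    obtain ⟨q, hq⟩ : ∃ q, n = 4 * q + 1 ∨ n = 4 * q + 2 ∨ n = 4 * q + 3 ∨ n = 4 * q + 4 :=
      ⟨(n - 1) / 4, by omega⟩
    obtain ⟨w0, w1, w2, w3⟩ := hm q (by omega) (by omega)
    rcases hq with rfl | rfl | rfl | rfl
    · rw [w0, show 4 * q + 1 - 1 = 4 * (q - 1) + 4 by ring, show 4 * q + 1 + 1 = 4 * q + 2 by ring,
        hφ, floquet_one, floquet_two, floquet_four, zpow_sub_one₀ hμ0]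
      linear_combination μ ^ q * h0
    · rw [w1, show 4 * q + 2 - 1 = 4 * q + 1 by ring, show 4 * q + 2 + 1 = 4 * q + 3 by ring,
        hφ, floquet_one, floquet_two, floquet_three]
      linear_combination μ ^ q * h1
    · rw [w2, show 4 * q + 3 - 1 = 4 * q + 2 by ring, show 4 * q + 3 + 1 = 4 * q + 4 by ring,
        hφ, floquet_two, floquet_three, floquet_four]
      linear_combination μ ^ q * h2
    · rw [w3, show 4 * q + 4 - 1 = 4 * q + 3 by ring,
        show 4 * q + 4 + 1 = 4 * (q + 1) + 1 by ring,
        hφ, floquet_one, floquet_three, floquet_four, zpow_add_one₀ hμ0]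
      linear_combination μ ^ q * h3
  have hnorm : ∀ n, ‖φ n‖ ^ 2 = (φ n).re ^ 2 + (φ n).im ^ 2 := fun n => by
    rw [← Complex.normSq_eq_norm_sq, Complex.normSq_apply]
    ring
  have hle : ∀ n, (φ n).re ^ 2 + (φ n).im ^ 2 ≤ S := fun n =>
    hnorm n ▸ norm_floquet_sq_le μ z₀ z₁ z₂ z₃ hμ n
  have hre := sum_sq_le_of_local_solution hK hc.le hbd (f := fun n => (φ n).re)
    (L := 4 * m + 1) (R := 4 * (m + N) + 1) (S := S) (by omega)
    (fun n => by linarith [hle n, sq_nonneg (φ n).im])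
    (fun n hn => by simpa using congrArg Complex.re (hsol n hn))
  have him := sum_sq_le_of_local_solution hK hc.le hbd (f := fun n => (φ n).im)
    (L := 4 * m + 1) (R := 4 * (m + N) + 1) (S := S) (by omega)
    (fun n => by linarith [hle n, sq_nonneg (φ n).re])
    (fun n hn => by simpa using congrArg Complex.im (hsol n hn))
  have htot := sum_norm_floquet_sq μ z₀ z₁ z₂ z₃ hμ m N
  rw [← hφ, Finset.sum_congr rfl fun n _ => hnorm n, Finset.sum_add_distrib, ← hS] at htot
  have hfin : c ^ 2 * (N * S) ≤ 8 * S := by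
    rw [← htot]
    linarith
  rw [div_lt_iff₀ (by positivity)] at hN
  nlinarith

theorem mem_spectrum_bdm {lam : ℝ} (hlam : |lam| ≤ 2) {ω : ℤ → ℤ}
    (hω : ∀ k, ω k = 0 ∨ ω k = 1)
    (hconst : ∀ n : ℕ, ∃ j : ℕ, ∀ k ∈ Finset.Ico ((j : ℤ) * n) (j * n + n), ω k = 0)
    (halt : ∀ n : ℕ, ∃ j : ℕ, ∀ k ∈ Finset.Ico ((j : ℤ) * n) (j * n + n), ω k = k % 2)
    {K : l2Z →L[ℝ] l2Z}
    (hK : ∀ u n, K u n = -u (n - 1) - u (n + 1) + Vbdm lam ω n * u n) {E : ℝ}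
    (hE₁ : Real.sqrt (1 + lam ^ 2 / 4) - 1 ≤ |E - lam / 2|)
    (hE₂ : |E - lam / 2| ≤ Real.sqrt (1 + lam ^ 2 / 4) + 1) :
    E ∈ spectrum ℝ K := by
  have hV : ∀ q : ℤ, Vbdm lam ω (4 * q + 1) = (if ω (2 * q) = 0 then lam else 0) ∧
      Vbdm lam ω (4 * q + 2) = (if ω (2 * q) = 0 then 0 else lam) ∧
      Vbdm lam ω (4 * q + 3) = (if ω (2 * q + 1) = 0 then lam else 0) ∧
      Vbdm lam ω (4 * q + 4) = (if ω (2 * q + 1) = 0 then 0 else lam) := fun q => by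
    rw [← Vbdm_odd lam hω, ← Vbdm_odd lam hω, ← Vbdm_even lam hω, ← Vbdm_even lam hω]
    ring_nf
    simp
  have ha0 : 0 ≤ lam ^ 2 / 4 := by positivity
  have ha1 : lam ^ 2 / 4 ≤ 1 := by nlinarith [sq_abs lam, abs_nonneg lam]
  set a := lam ^ 2 / 4 with ha
  set y := (E - lam / 2) ^ 2 with hy
  by_cases hya : a ≤ y ∧ y ≤ a + 4
  · refine mem_spectrum_of_periodic_windows hK (c₀ := lam - E) (c₁ := 0 - E)
      (c₂ := lam - E) (c₃ := 0 - E) ?_ fun N => ?_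
    · have : (lam - E) * (0 - E) * (lam - E) * (0 - E) - (lam - E) * (0 - E)
          - (0 - E) * (lam - E) - (lam - E) * (0 - E) - (0 - E) * (lam - E) + 2 =
          (y - a - 2) ^ 2 - 2 := by
        rw [hy, ha]; ring
      rw [this, abs_le]
      constructor <;> nlinarith
    · obtain ⟨j, hj⟩ := hconst (2 * N)
      refine ⟨j * N, fun q h1 h2 => ?_⟩
      obtain ⟨v1, v2, v3, v4⟩ := hV q
      push_cast at hj
      rw [v1, v2, v3, v4, hj (2 * q) (Finset.mem_Ico.2 ⟨by linarith, by linarith⟩),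
        hj (2 * q + 1) (Finset.mem_Ico.2 ⟨by linarith, by
          have : q + 1 ≤ j * N + N := h2
          linarith⟩)]
      simp
  · refine mem_spectrum_of_periodic_windows hK (c₀ := lam - E) (c₁ := 0 - E)
      (c₂ := 0 - E) (c₃ := lam - E) ?_ fun N => ?_
    · have : (lam - E) * (0 - E) * (0 - E) * (lam - E) - (lam - E) * (0 - E)
          - (0 - E) * (0 - E) - (0 - E) * (lam - E) - (lam - E) * (lam - E) + 2 =
          (y - a) ^ 2 - 4 * y + 2 := by
        rw [hy, ha]; ring
      rw [this, abs_le]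
      constructor
      · rw [not_and_or, not_le, not_le] at hya
        rcases hya with h | h
        · nlinarith [sq_nonneg (y - a)]
        · nlinarith
      · have hr : Real.sqrt (1 + a) ^ 2 = 1 + a := Real.sq_sqrt (by linarith)
        have hr1 : 1 ≤ Real.sqrt (1 + a) := Real.one_le_sqrt.2 (by linarith)
        set r := Real.sqrt (1 + a)
        have hy2 : y = |E - lam / 2| ^ 2 := by rw [hy, sq_abs]
        have hlow : (r - 1) ^ 2 ≤ y := by
          rw [hy2]
          exact pow_le_pow_left₀ (by linarith) hE₁ 2
        have hupp : y ≤ (r + 1) ^ 2 := by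
          rw [hy2]
          exact pow_le_pow_left₀ (abs_nonneg _) hE₂ 2
        have hprod : (y - a) ^ 2 - 4 * y = (y - (r - 1) ^ 2) * (y - (r + 1) ^ 2) := by
          rw [show a = r ^ 2 - 1 by linarith]
          ring
        nlinarith [mul_nonneg (sub_nonneg.2 hlow) (sub_nonneg.2 hupp)]
    · obtain ⟨j, hj⟩ := halt (2 * N)
      refine ⟨j * N, fun q h1 h2 => ?_⟩
      obtain ⟨v1, v2, v3, v4⟩ := hV q
      push_cast at hj
      rw [v1, v2, v3, v4, hj (2 * q) (Finset.mem_Ico.2 ⟨by linarith, by linarith⟩),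
        hj (2 * q + 1) (Finset.mem_Ico.2 ⟨by linarith, by
          have : q + 1 ≤ j * N + N := h2
          linarith⟩)]
      simp

/-- **Almost sure spectrum of the Bernoulli displacement model for `0 < |λ| ≤ 2`.**
With i.i.d. displacements, `ℙ(ω_k = 0) = p`, `ℙ(ω_k = 1) = 1 - p`, `p ∈ (0,1)`,
almost surely `σ(h_{ω,λ}) = [E₋(λ), E₊(λ)] ∖ (G₋(λ), G₊(λ))`, where
`E_±(λ) = λ/2 ± √(2 + λ²/4 + √(4+λ²))` and `G_±(λ) = λ/2 ± √(2 + λ²/4 − √(4+λ²))`. -/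
theorem bdm_almost_sure_spectrum
    (lam : ℝ) (hlam0 : lam ≠ 0) (hlam2 : |lam| ≤ 2)
    (p : ℝ) (hp : 0 < p) (hp1 : p < 1)
    (P : Measure (ℤ → ℤ)) [IsProbabilityMeasure P]
    (hsupp : P {ω | ∀ k, ω k = 0 ∨ ω k = 1} = 1)
    (hiid : ∀ (s : Finset ℤ) (g : ℤ → ℤ), (∀ k ∈ s, g k = 0 ∨ g k = 1) →
      P {ω | ∀ k ∈ s, ω k = g k} =
        ∏ k ∈ s, (if g k = 0 then ENNReal.ofReal p else ENNReal.ofReal (1 - p)))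
    (H : (ℤ → ℤ) → (l2Z →L[ℝ] l2Z))
    (hH : ∀ ω : ℤ → ℤ, (∀ k, ω k = 0 ∨ ω k = 1) → ∀ (u : l2Z) (n : ℤ),
      (H ω u) n = -u (n - 1) - u (n + 1) + Vbdm lam ω n * u n) :
    ∀ᵐ ω ∂P, spectrum ℝ (H ω) =
      Set.Icc (lam / 2 - Real.sqrt (2 + lam ^ 2 / 4 + Real.sqrt (4 + lam ^ 2)))
              (lam / 2 + Real.sqrt (2 + lam ^ 2 / 4 + Real.sqrt (4 + lam ^ 2)))
      \ Set.Ioo (lam / 2 - Real.sqrt (2 + lam ^ 2 / 4 - Real.sqrt (4 + lam ^ 2)))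
                (lam / 2 + Real.sqrt (2 + lam ^ 2 / 4 - Real.sqrt (4 + lam ^ 2))) := by
  have hω : ∀ᵐ ω ∂P, ∀ k, ω k = 0 ∨ ω k = 1 := by
    refine (mem_ae_iff_prob_eq_one ?_).2 hsupp
    have : {ω : ℤ → ℤ | ∀ k, ω k = 0 ∨ ω k = 1} =
        ⋂ k, (fun ω : ℤ → ℤ => ω k) ⁻¹' {0, 1} := by
      ext ω
      simp
    rw [this]
    exact MeasurableSet.iInter fun k =>
      measurable_pi_apply k (Set.toFinite _).measurableSet
  have hconst := ae_all_iff.2 fun n : ℕ =>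
    ae_exists_block_eq hp hp1 P hiid (fun _ => 0) (fun _ => .inl rfl) n
  have halt := ae_all_iff.2 fun n : ℕ =>
    ae_exists_block_eq hp hp1 P hiid (fun k => k % 2) (fun k => Int.emod_two_eq_zero_or_one k) n
  filter_upwards [hω, hconst, halt] with ω hω hconst halt
  have hK := hH ω hω
  have hr : Real.sqrt (1 + lam ^ 2 / 4) ^ 2 = 1 + lam ^ 2 / 4 := Real.sq_sqrt (by positivity)
  have hr1 : 1 ≤ Real.sqrt (1 + lam ^ 2 / 4) := Real.one_le_sqrt.2 (by nlinarith [sq_nonneg lam])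
  set r := Real.sqrt (1 + lam ^ 2 / 4) with hrdef
  have hs : Real.sqrt (4 + lam ^ 2) = 2 * r := by
    rw [Real.sqrt_eq_iff_mul_self_eq (by positivity) (by linarith)]
    nlinarith
  have hplus : Real.sqrt (2 + lam ^ 2 / 4 + Real.sqrt (4 + lam ^ 2)) = r + 1 := by
    rw [hs, show 2 + lam ^ 2 / 4 + 2 * r = (r + 1) ^ 2 by linarith, Real.sqrt_sq (by linarith)]
  have hminus : Real.sqrt (2 + lam ^ 2 / 4 - Real.sqrt (4 + lam ^ 2)) = r - 1 := by
    rw [hs, show 2 + lam ^ 2 / 4 - 2 * r = (r - 1) ^ 2 by linarith, Real.sqrt_sq (by linarith)]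
  rw [hplus, hminus]
  ext E
  have hmem : E ∈ Set.Icc (lam / 2 - (r + 1)) (lam / 2 + (r + 1)) \
      Set.Ioo (lam / 2 - (r - 1)) (lam / 2 + (r - 1)) ↔
      r - 1 ≤ |E - lam / 2| ∧ |E - lam / 2| ≤ r + 1 := by
    rw [and_comm, abs_le, ← not_lt (a := |E - lam / 2|), abs_lt, Set.mem_sdiff,
      Set.mem_Icc, Set.mem_Ioo]
    refine and_congr ?_ (not_congr ?_) <;>
      exact and_congr ⟨fun h => by linarith, fun h => by linarith⟩
        ⟨fun h => by linarith, fun h => by linarith⟩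
  rw [hmem]
  constructor
  · intro hE
    by_contra hcon
    refine notMem_spectrum_bdm hω hK ?_ hE
    rwa [not_and_or, not_le, not_le] at hcon
  · rintro ⟨h1, h2⟩
    exact mem_spectrum_bdm hlam2 hω hconst halt hK h1 h2
end
end

section
/- Consider the symmetric Bernoulli displacement model (p = 1/2). For every L ∈ ℕ and every t ∈ ℝ, 𝔼[ #{k : E_k(h^D_{Λ(L)}(ω)) < E_−(λ) + t} ] = 2L − 𝔼[ #{k : E_k(h^N_{Λ(L)}(ω)) ≤ E_+(λ) − t} ], where eigenvalues are counted with multiplicity. (Dividing by 2L and letting L → ∞, this yields the symmetry N_λ(E_−(λ)+t) = 1 − N_λ(E_+(λ)−t) of the integrated density of states.) -/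
open scoped BigOperators ENNReal
open MeasureTheory

noncomputable section

/-- The set of nearest neighbors of a point of `ℤ`. -/
def nbhd1 (n : ℤ) : Finset ℤ := {n - 1, n + 1}

/-- `n_S(i)`: the number of nearest neighbors of `i` lying outside `S ⊂ ℤ`. -/
def nOut1 (S : Finset ℤ) (i : ℤ) : ℕ :=
  ((nbhd1 i).filter fun j => j ∉ S).card

/-- The Dirichlet restriction `h^D_S = h_{0,S} + N_S + V` on the finite set `S ⊂ ℤ`. -/
def dirMat (S : Finset ℤ) (V : ℤ → ℝ) : Matrix S S ℝ :=
  fun i j => (if |(i : ℤ) - (j : ℤ)| = 1 then (-1 : ℝ) else 0)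
    + (if i = j then (V (i : ℤ) + (nOut1 S (i : ℤ) : ℝ)) else 0)

/-- The Neumann restriction `h^N_S = h_{0,S} - N_S + V` on the finite set `S ⊂ ℤ`. -/
def neuMat (S : Finset ℤ) (V : ℤ → ℝ) : Matrix S S ℝ :=
  fun i j => (if |(i : ℤ) - (j : ℤ)| = 1 then (-1 : ℝ) else 0)
    + (if i = j then (V (i : ℤ) - (nOut1 S (i : ℤ) : ℝ)) else 0)

/-- The number of eigenvalues (counted with multiplicity, i.e. roots of the
characteristic polynomial) that are `< E`. -/
def countLT {n : Type*} [Fintype n] [DecidableEq n] (A : Matrix n n ℝ) (E : ℝ) : ℕ :=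
  (A.charpoly.roots.filter (fun x => x < E)).card

/-- The number of eigenvalues (counted with multiplicity) that are `≤ E`. -/
def countLE {n : Type*} [Fintype n] [DecidableEq n] (A : Matrix n n ℝ) (E : ℝ) : ℕ :=
  (A.charpoly.roots.filter (fun x => x ≤ E)).card

section Spectral

variable {n : Type*} [Fintype n] [DecidableEq n]

theorem Matrix.charpoly_scalar_sub (A : Matrix n n ℝ) (c : ℝ) :
    (Matrix.scalar n c - A).charpoly =
      Polynomial.C ((-1) ^ Fintype.card n) *
        A.charpoly.comp (Polynomial.C (-1) * Polynomial.X + Polynomial.C c) := by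
  refine Polynomial.funext fun x => ?_
  have h : Matrix.scalar n x - (Matrix.scalar n c - A) =
      -(Matrix.scalar n (-1 * x + c) - A) := by
    simp only [map_add, map_mul, map_neg, map_one]
    noncomm_ring
  simp only [Polynomial.eval_mul, Polynomial.eval_C, Polynomial.eval_comp, Polynomial.eval_add,
    Polynomial.eval_X, Matrix.eval_charpoly]
  rw [h, Matrix.det_neg]

theorem Matrix.roots_charpoly_scalar_sub (A : Matrix n n ℝ) (c : ℝ) :
    (Matrix.scalar n c - A).charpoly.roots = A.charpoly.roots.map fun x => c - x := by
  rw [Matrix.charpoly_scalar_sub, Polynomial.roots_C_mul _ (by positivity),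
    Polynomial.roots_comp_C_mul_X_add_C _ _ _ isUnit_one.neg]
  refine Multiset.map_congr rfl fun x _ => ?_
  simp

theorem countLT_scalar_sub_add_countLE {A : Matrix n n ℝ} (hA : A.IsHermitian) (c E : ℝ) :
    countLT (Matrix.scalar n c - A) (c - E) + countLE A E = Fintype.card n := by
  have hcard : A.charpoly.roots.card = Fintype.card n := by
    rw [hA.roots_charpoly_eq_eigenvalues]
    simp
  rw [countLT, countLE, Matrix.roots_charpoly_scalar_sub, Multiset.filter_map, Multiset.card_map,
    ← hcard, add_comm]
  simp only [Function.comp_def, sub_lt_sub_iff_left]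
  rw [← Multiset.card_add]
  simp only [← not_le]
  rw [Multiset.filter_add_not]

end Spectral

theorem neuMat_isHermitian (S : Finset ℤ) (V : ℤ → ℝ) : (neuMat S V).IsHermitian := by
  refine Matrix.IsHermitian.ext fun i j => ?_
  simp only [neuMat, star_trivial, abs_sub_comm (j : ℤ), eq_comm (a := j)]
  congr 1
  split_ifs with h
  · rw [h]
  · rfl

/-- The staggered sign conjugation exchanges the Dirichlet and Neumann restrictions. -/
theorem charpoly_dirMat_const_sub (S : Finset ℤ) (V : ℤ → ℝ) (c : ℝ) :
    (dirMat S fun m => c - V m).charpoly = (Matrix.scalar S c - neuMat S V).charpoly := by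
  let s : S → ℝ := fun i => ((Int.negOnePow (i : ℤ) : ℤ) : ℝ)
  have hs (i : S) : s i * s i = 1 := by
    simp only [s, ← Int.cast_mul, ← Units.val_mul, Int.units_mul_self]
    simp
  have hadj (i j : S) (h : |(i : ℤ) - (j : ℤ)| = 1) : s i * s j = -1 := by
    have h' : s i = -s j := by
      simp only [s]
      rcases (abs_eq zero_le_one).1 h with h | h
      · rw [show (i : ℤ) = j + 1 by lia, Int.negOnePow_succ]
        push_cast
        ring
      · rw [show (j : ℤ) = i + 1 by lia, Int.negOnePow_succ]
        push_cast
        ring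
    rw [h', neg_mul, hs]
  have hconj : (dirMat S fun m => c - V m) =
      Matrix.diagonal s * ((Matrix.scalar S c - neuMat S V) * Matrix.diagonal s) := by
    ext i j
    rw [Matrix.diagonal_mul, Matrix.mul_diagonal]
    simp only [dirMat, neuMat, Matrix.sub_apply, Matrix.scalar_apply, Matrix.diagonal_apply]
    rcases eq_or_ne i j with rfl | hij
    · simp only [sub_self, abs_zero, zero_ne_one, if_true, if_false]
      linear_combination -(c - V i + nOut1 S i) * hs i
    · by_cases h : |(i : ℤ) - (j : ℤ)| = 1
      · simp only [h, hij, if_true, if_false]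
        linear_combination -hadj i j h
      · simp [h, hij]
  rw [hconj, Matrix.charpoly_mul_comm, mul_assoc, Matrix.diagonal_mul_diagonal]
  simp [hs]

/-- The involution of the sample space exchanging the displacements `0` and `1`. -/
def flipEquiv : (ℤ → ℤ) ≃ᵐ (ℤ → ℤ) :=
  MeasurableEquiv.piCongrRight fun _ =>
    { Equiv.subLeft (1 : ℤ) with
      measurable_toFun := measurable_of_countable _
      measurable_invFun := measurable_of_countable _ }

theorem flipEquiv_apply (ω : ℤ → ℤ) (k : ℤ) : flipEquiv ω k = 1 - ω k := rfl

theorem Vbdm_flipEquiv (lam : ℝ) {ω : ℤ → ℤ} (hω : ∀ k, ω k = 0 ∨ ω k = 1) (m : ℤ) :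
    Vbdm lam (flipEquiv ω) m = lam - Vbdm lam ω m := by
  have h : (∃ k : ℤ, m = 2 * k + 1 + flipEquiv ω k) ↔ ¬ ∃ k : ℤ, m = 2 * k + 1 + ω k := by
    simp only [flipEquiv_apply]
    constructor
    · rintro ⟨k, hk⟩ ⟨l, hl⟩
      rcases hω k with h | h <;> rcases hω l with h' | h' <;>
        (obtain rfl : k = l := by lia) <;> lia
    · intro hne
      refine ⟨(m - 1) / 2, ?_⟩
      have hne' : ¬ m = 2 * ((m - 1) / 2) + 1 + ω ((m - 1) / 2) := fun e => hne ⟨_, e⟩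
      rcases hω ((m - 1) / 2) with h | h <;> rw [h] at hne' ⊢ <;> omega
  by_cases hm : ∃ k : ℤ, m = 2 * k + 1 + ω k
  · rw [Vbdm, Vbdm, if_neg (by rw [h]; exact not_not.2 hm), if_pos hm, sub_self]
  · rw [Vbdm, Vbdm, if_pos (h.2 hm), if_neg hm, sub_zero]

theorem measurable_comp_neuMat_Vbdm (lam : ℝ) (S : Finset ℤ) (F : Matrix S S ℝ → ℝ) :
    Measurable fun ω => F (neuMat S (Vbdm lam ω)) := by
  classical
  let v : (ℤ → ℤ) → S → Prop := fun ω m => ∃ k : ℤ, (m : ℤ) = 2 * k + 1 + ω k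
  have hv : Measurable v := by
    refine measurable_pi_lambda _ fun m => Measurable.exists fun k => ?_
    exact measurable_to_prop (measurableSet_eq_fun (by fun_prop) (by fun_prop))
  let G : (S → Prop) → ℝ := fun p =>
    F (neuMat S fun m => if h : m ∈ S then if p ⟨m, h⟩ then lam else 0 else 0)
  have hG : (fun ω => F (neuMat S (Vbdm lam ω))) = G ∘ v := by
    funext ω
    simp only [Function.comp_apply, G, v]
    congr 1
    ext i j
    simp [neuMat, Vbdm]
  rw [hG]
  exact (measurable_of_countable G).comp hv

theorem map_flipEquiv (P : Measure (ℤ → ℤ)) [IsProbabilityMeasure P]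
    (hsupp : ∀ᵐ ω ∂P, ∀ k, ω k = 0 ∨ ω k = 1)
    (hiid : ∀ (s : Finset ℤ) (g : ℤ → ℤ), (∀ k ∈ s, g k = 0 ∨ g k = 1) →
      P {ω | ∀ k ∈ s, ω k = g k} = ∏ _k ∈ s, (1 / 2 : ℝ≥0∞)) :
    P.map flipEquiv = P := by
  have hlim : IsProjectiveLimit (P.map flipEquiv) fun I : Finset ℤ => P.map I.restrict := by
    intro I
    refine Measure.ext_of_singleton fun a : I → ℤ => ?_
    have hI : Measurable (I.restrict : (ℤ → ℤ) → I → ℤ) := Finset.measurable_restrict I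
    rw [Measure.map_apply hI (measurableSet_singleton a),
      Measure.map_apply hI (measurableSet_singleton a), flipEquiv.map_apply]
    let g : ℤ → ℤ := fun k => if h : k ∈ I then a ⟨k, h⟩ else 0
    have hg : (I.restrict : (ℤ → ℤ) → I → ℤ) ⁻¹' {a} = {ω : ℤ → ℤ | ∀ k ∈ I, ω k = g k} := by
      ext ω
      simp only [Set.mem_preimage, Set.mem_singleton_iff, funext_iff, Subtype.forall,
        Finset.restrict_def, Set.mem_ofPred_eq, g]
      exact forall₂_congr fun k hk => by rw [dif_pos hk]
    have hflip : flipEquiv ⁻¹' {ω : ℤ → ℤ | ∀ k ∈ I, ω k = g k} =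
        {ω | ∀ k ∈ I, ω k = 1 - g k} := by
      ext ω
      simp only [Set.mem_preimage, Set.mem_ofPred_eq, flipEquiv_apply]
      exact forall₂_congr fun k _ => by lia
    rw [hg, hflip]
    by_cases h01 : ∀ k ∈ I, g k = 0 ∨ g k = 1
    · rw [hiid I g h01, hiid I (fun k => 1 - g k) fun k hk => by
        rcases h01 k hk with h | h <;> simp [h]]
    · push Not at h01
      obtain ⟨k, hk, h0, h1⟩ := h01
      have hnull {b : ℤ → ℤ} (hb0 : b k ≠ 0) (hb1 : b k ≠ 1) :
          P {ω | ∀ k ∈ I, ω k = b k} = 0 :=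
        measure_eq_zero_iff_ae_notMem.2 <| hsupp.mono fun ω h hω => by
          rcases h k with h | h <;> simp_all [hω k hk]
      rw [hnull h0 h1, hnull (by lia) (by lia)]
  exact hlim.unique fun _ => rfl

/-- **Finite-volume symmetry of the eigenvalue counting functions** for the symmetric
Bernoulli displacement model (`p = 1/2`):
`𝔼[#{k : E_k(h^D_{Λ(L)}(ω)) < E₋(λ)+t}] = 2L − 𝔼[#{k : E_k(h^N_{Λ(L)}(ω)) ≤ E₊(λ)−t}]`,
where `Λ(L) = [1, 2L]` and `E_±(λ) = λ/2 ± √(2 + λ²/4 + √(4+λ²))`.  (Dividing by `2L`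
and letting `L → ∞` yields the symmetry `N_λ(E₋+t) = 1 − N_λ(E₊−t)` of the IDS.) -/
theorem bdm_ids_symmetry
    (lam : ℝ) (hlam : lam ≠ 0)
    (P : Measure (ℤ → ℤ)) [IsProbabilityMeasure P]
    (hsupp : P {ω | ∀ k, ω k = 0 ∨ ω k = 1} = 1)
    (hiid : ∀ (s : Finset ℤ) (g : ℤ → ℤ), (∀ k ∈ s, g k = 0 ∨ g k = 1) →
      P {ω | ∀ k ∈ s, ω k = g k} = ∏ _k ∈ s, (1 / 2 : ℝ≥0∞))
    (L : ℕ) (t : ℝ) :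
    ∫ ω, (countLT (dirMat (Finset.Icc 1 (2 * (L : ℤ))) (Vbdm lam ω))
        ((lam / 2 - Real.sqrt (2 + lam ^ 2 / 4 + Real.sqrt (4 + lam ^ 2))) + t) : ℝ) ∂P
      = 2 * L - ∫ ω, (countLE (neuMat (Finset.Icc 1 (2 * (L : ℤ))) (Vbdm lam ω))
        ((lam / 2 + Real.sqrt (2 + lam ^ 2 / 4 + Real.sqrt (4 + lam ^ 2))) - t) : ℝ) ∂P := by
  have hae : ∀ᵐ ω ∂P, ∀ k, ω k = 0 ∨ ω k = 1 := by
    have hm : MeasurableSet {ω : ℤ → ℤ | ∀ k, ω k = 0 ∨ ω k = 1} := by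
      simp only [Set.ofPred_forall, Set.ofPred_or]
      refine MeasurableSet.iInter fun k => MeasurableSet.union ?_ ?_ <;>
        exact measurableSet_eq_fun (measurable_pi_apply k) measurable_const
    exact (prob_compl_eq_zero_iff hm).2 hsupp
  set S := Finset.Icc 1 (2 * (L : ℤ)) with hS
  set r := Real.sqrt (2 + lam ^ 2 / 4 + Real.sqrt (4 + lam ^ 2))
  have hcard : Fintype.card S = 2 * L := by
    simp only [hS, Fintype.card_coe, Int.card_Icc]
    lia
  have hsum {ω : ℤ → ℤ} (hω : ∀ k, ω k = 0 ∨ ω k = 1) :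
      (countLT (dirMat S (Vbdm lam (flipEquiv ω))) (lam / 2 - r + t) : ℝ) =
        2 * L - (countLE (neuMat S (Vbdm lam ω)) (lam / 2 + r - t) : ℝ) := by
    have h := countLT_scalar_sub_add_countLE (neuMat_isHermitian S (Vbdm lam ω)) lam
      (lam / 2 + r - t)
    rw [countLT, ← charpoly_dirMat_const_sub, ← funext (Vbdm_flipEquiv lam hω), ← countLT, hcard,
      show lam - (lam / 2 + r - t) = lam / 2 - r + t by ring] at h
    rw [eq_sub_iff_add_eq]
    exact_mod_cast h
  have hint : Integrable
      (fun ω => (countLE (neuMat S (Vbdm lam ω)) (lam / 2 + r - t) : ℝ)) P := by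
    refine Integrable.of_bound (C := 2 * L) (measurable_comp_neuMat_Vbdm lam S
      fun A => (countLE A (lam / 2 + r - t) : ℝ)).aestronglyMeasurable ?_
    filter_upwards [hae] with ω hω
    rw [Real.norm_of_nonneg (Nat.cast_nonneg _), ← sub_nonneg, ← hsum hω]
    exact Nat.cast_nonneg _
  nth_rewrite 1 [← map_flipEquiv P hae hiid]
  rw [integral_map_equiv, integral_congr_ae (hae.mono fun ω hω => hsum hω),
    integral_sub (integrable_const _) hint]
  simp
end
end

section
/- Fix λ ∈ ℝ. For each ω ∈ {0,1}^ℤ define the potential q_ω : ℤ → ℝ by q_ω(k) = λ(ω_{k+1} − ω_k). Then for every ω ∈ {0,1}^ℤ the discrete Schrödinger operators h_0 + q_ω and h_0 − q_ω on ℓ²(ℤ) are bounded below by −√(4+λ²); that is, ⟨u, (h_0 ± q_ω) u⟩ ≥ −√(4+λ²) ‖u‖² for all u ∈ ℓ²(ℤ). -/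
noncomputable section

/-- A discrete Schrödinger operator `h₀ + q` is bounded below by `-E` whenever `E + q` splits as
`r n + s (n - 1)` with `r` bounded and nonnegative, `s` nonnegative and `r n * s n = 1`. -/
theorem schrodinger_bounded_below {E C : ℝ} {q r s : ℤ → ℝ} {H : l2Z →L[ℝ] l2Z}
    (hH : ∀ (u : l2Z) (n : ℤ), (H u) n = -u (n - 1) - u (n + 1) + q n * u n)
    (hr : ∀ n, 0 ≤ r n) (hrC : ∀ n, r n ≤ C) (hs : ∀ n, 0 ≤ s n) (hrs : ∀ n, r n * s n = 1)
    (hq : ∀ n, r n + s (n - 1) = E + q n) (u : l2Z) :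
    -E * ‖u‖ ^ 2 ≤ inner (𝕜 := ℝ) u (H u) := by
  have hnorm : HasSum (fun n => u n * u n) (‖u‖ ^ 2) := by
    rw [← real_inner_self_eq_norm_sq]
    exact lp.hasSum_inner (𝕜 := ℝ) u u
  have htotal : HasSum (fun n => E * (u n * u n) + (H u) n * u n)
      (E * ‖u‖ ^ 2 + inner (𝕜 := ℝ) u (H u)) :=
    (hnorm.mul_left E).add (lp.hasSum_inner (𝕜 := ℝ) u (H u))
  let g : ℤ → ℝ := fun n => r n * (u n * u n) - u n * u (n + 1)
  let h : ℤ → ℝ := fun n => s n * (u (n + 1) * u (n + 1)) - u n * u (n + 1)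
  have hsplit : ∀ n, E * (u n * u n) + (H u) n * u n - g n = h (n - 1) := by
    intro n
    simp only [g, h, hH, sub_add_cancel]
    linear_combination -(u n * u n) * hq n
  have hshift : Summable (fun n : ℤ => u (n + 1) * u (n + 1)) :=
    (Equiv.addRight (1 : ℤ)).summable_iff.mpr hnorm.summable
  have hg : Summable g := by
    refine Summable.of_norm_bounded ((hnorm.summable.mul_left C).add
      (hnorm.summable.add hshift)) fun n => ?_
    have h₁ := mul_le_mul_of_nonneg_right (hrC n) (mul_self_nonneg (u n))
    have h₂ := mul_nonneg (hr n) (mul_self_nonneg (u n))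
    rw [Real.norm_eq_abs, abs_le]
    constructor <;> simp only [g] <;>
      nlinarith [mul_self_nonneg (u n - u (n + 1)), mul_self_nonneg (u n + u (n + 1)),
        mul_self_nonneg (u n), mul_self_nonneg (u (n + 1))]
  have hh : HasSum h (E * ‖u‖ ^ 2 + inner (𝕜 := ℝ) u (H u) - ∑' n, g n) := by
    rw [← (Equiv.subRight (1 : ℤ)).hasSum_iff]
    exact (htotal.sub hg.hasSum).congr_fun fun n => (hsplit n).symm
  have hpos : ∀ n, 0 ≤ g n + h n := by
    intro n
    have hsq : g n + h n = (√(r n) * u n - √(s n) * u (n + 1)) ^ 2 := by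
      have h₁ : √(r n) * √(s n) = 1 := by rw [← Real.sqrt_mul (hr n), hrs, Real.sqrt_one]
      simp only [g, h]
      linear_combination 2 * u n * u (n + 1) * h₁ - u n ^ 2 * Real.sq_sqrt (hr n)
        - u (n + 1) ^ 2 * Real.sq_sqrt (hs n)
    rw [hsq]
    positivity
  have := (hg.hasSum.add hh).nonneg hpos
  linarith

/-- The lower bound for the potential `μ (ω (n + 1) - ω n)`, with either sign of `μ`. -/
theorem schrodinger_gradient_bounded_below {μ : ℝ} {ω : ℤ → ℤ} (hω : ∀ k, ω k = 0 ∨ ω k = 1)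
    {H : l2Z →L[ℝ] l2Z}
    (hH : ∀ (u : l2Z) (n : ℤ),
      (H u) n = -u (n - 1) - u (n + 1) + μ * ((ω (n + 1) - ω n : ℤ) : ℝ) * u n) (u : l2Z) :
    -√(4 + μ ^ 2) * ‖u‖ ^ 2 ≤ inner (𝕜 := ℝ) u (H u) := by
  have hE : √(4 + μ ^ 2) ^ 2 = 4 + μ ^ 2 := Real.sq_sqrt (by positivity)
  have hμ : |μ| ≤ √(4 + μ ^ 2) := Real.abs_le_sqrt (by linarith)
  obtain ⟨hμ₁, hμ₂⟩ := abs_le.mp hμ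
  have hsign : ∀ n, (ω n : ℝ) = 0 ∨ (ω n : ℝ) = 1 := fun n => by exact_mod_cast hω n
  refine schrodinger_bounded_below (C := √(4 + μ ^ 2))
    (r := fun n => (√(4 + μ ^ 2) + μ * (2 * ω (n + 1) - 1)) / 2)
    (s := fun n => (√(4 + μ ^ 2) - μ * (2 * ω (n + 1) - 1)) / 2) hH ?_ ?_ ?_ ?_ ?_ u <;>
    intro n
  · rcases hsign (n + 1) with h | h <;> simp only [h] <;> linarith
  · rcases hsign (n + 1) with h | h <;> simp only [h] <;> linarith
  · rcases hsign (n + 1) with h | h <;> simp only [h] <;> linarith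
  · rcases hsign (n + 1) with h | h <;> simp only [h] <;> linear_combination hE / 4
  · simp only [sub_add_cancel]
    push_cast
    ring

/-- **Lower bound for the auxiliary operators `h₀ ± q_ω`.**  Fix `λ ∈ ℝ` and
`ω ∈ {0,1}^ℤ`, and let `q_ω(k) = λ(ω_{k+1} − ω_k)`.  Then the discrete Schrödinger
operators `h₀ + q_ω` and `h₀ − q_ω` are bounded below by `−√(4+λ²)`:
`⟨u, (h₀ ± q_ω) u⟩ ≥ −√(4+λ²) ‖u‖²` for all `u ∈ ℓ²(ℤ)`. -/
theorem aux_operators_bounded_below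
    (lam : ℝ)
    (ω : ℤ → ℤ) (hω : ∀ k, ω k = 0 ∨ ω k = 1)
    (Hp Hm : l2Z →L[ℝ] l2Z)
    (hHp : ∀ (u : l2Z) (n : ℤ),
      (Hp u) n = -u (n - 1) - u (n + 1) + (lam * ((ω (n + 1) - ω n : ℤ) : ℝ)) * u n)
    (hHm : ∀ (u : l2Z) (n : ℤ),
      (Hm u) n = -u (n - 1) - u (n + 1) - (lam * ((ω (n + 1) - ω n : ℤ) : ℝ)) * u n) :
    ∀ u : l2Z,
      -Real.sqrt (4 + lam ^ 2) * ‖u‖ ^ 2 ≤ inner (𝕜 := ℝ) u (Hp u)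
      ∧ -Real.sqrt (4 + lam ^ 2) * ‖u‖ ^ 2 ≤ inner (𝕜 := ℝ) u (Hm u) := by
  intro u
  refine ⟨schrodinger_gradient_bounded_below hω hHp u, ?_⟩
  rw [← neg_sq lam]
  exact schrodinger_gradient_bounded_below hω (fun v n => by rw [hHm]; ring) u
end
end
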